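/- Let g(m) denote the number of centrosymmetric involutions of {1,2,…,m} that avoid both of the patterns 1243 and 2143. Then g(2n) = g(2n+1) for all n ≥ 1; moreover g(2) = 2, g(4) = 5, and g(2n) = 2 g(2n−2) + g(2n−4) for all n ≥ 3. (That is, |CI_{2n}(1243,2143)| = |CI_{2n+1}(1243,2143)| = p_n where p_1 = 2, p_2 = 5 and p_n = 2 p_{n−1} + p_{n−2} for n ≥ 3, the Pell recursion.) -/

import Mathlib

/-- A step of a lattice path: `E = (1,0)`, `N = (0,1)`, `D = (1,1)`. -/
inductive Step : Type
  | E : Step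
  | N : Step
  | D : Step
  deriving DecidableEq

/-- The x-coordinate of the lattice point reached after performing the steps `q`
(starting from the origin). -/
def posX (q : List Step) : ℕ := q.count Step.E + q.count Step.D

/-- The y-coordinate of the lattice point reached after performing the steps `q`
(starting from the origin). -/
def posY (q : List Step) : ℕ := q.count Step.N + q.count Step.D

/-- A Schröder prefix: a lattice path starting at the origin which never passes
below the line `y = x`. -/
def IsSchroderPrefix (p : List Step) : Prop :=
  ∀ q : List Step, q <+: p → posX q ≤ posY q

/-- A Schröder path of length `n`: a Schröder prefix terminating at `(n, n)`. -/
def IsSchroderPath (n : ℕ) (p : List Step) : Prop :=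
  IsSchroderPrefix p ∧ posX p = n ∧ posY p = n

/-- Interchange `E` and `N` steps. -/
def revStep : Step → Step
  | Step.E => Step.N
  | Step.N => Step.E
  | Step.D => Step.D

/-- The reversal of a Schröder path: write the steps in reverse order and
interchange `E` and `N` steps. -/
def revPath (p : List Step) : List Step := p.reverse.map revStep

/-- Words which are concatenations of blocks, each block being a single `D` step or
of the form `N^k E^k` for some `k > 0`. -/
inductive IsInnerWord : List Step → Prop
  | nil : IsInnerWord []
  | dcons {p : List Step} : IsInnerWord p → IsInnerWord (Step.D :: p)
  | peak {k : ℕ} {p : List Step} : 0 < k → IsInnerWord p →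
      IsInnerWord (List.replicate k Step.N ++ List.replicate k Step.E ++ p)

/-- Words which are concatenations of blocks, each block being a single `D` step or of
the form `N q E` where `q` is an inner word. -/
inductive IsDWord : List Step → Prop
  | nil : IsDWord []
  | dcons {p : List Step} : IsDWord p → IsDWord (Step.D :: p)
  | block {q p : List Step} : IsInnerWord q → IsDWord p →
      IsDWord (Step.N :: (q ++ Step.E :: p))

/-- Membership in `𝒟_n`: a Schröder path of length `n` of the prescribed block form. -/
def MemD (n : ℕ) (p : List Step) : Prop := IsDWord p ∧ IsSchroderPath n p

/-- Membership in `𝒟`: Schröder prefixes occurring as initial segments of some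
path in `𝒟_m` for some finite `m`. -/
def MemCalD (p : List Step) : Prop := ∃ (m : ℕ) (q : List Step), p <+: q ∧ MemD m q

/-- `p` has a level feature at `t`: a `D` step joining `(t-1, t)` to `(t, t+1)`. -/
def HasLevelFeatureAt (p : List Step) (t : ℕ) : Prop :=
  1 ≤ t ∧ ∃ q r : List Step, p = q ++ Step.D :: r ∧ posX q = t - 1 ∧ posY q = t

/-- `p` has a notch feature at `t`: an `E` step joining `(t-1, t)` to `(t, t)`
immediately followed by an `N` step joining `(t, t)` to `(t, t+1)`. -/
def HasNotchFeatureAt (p : List Step) (t : ℕ) : Prop :=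
  1 ≤ t ∧ ∃ q r : List Step, p = q ++ Step.E :: Step.N :: r ∧ posX q = t - 1 ∧ posY q = t

/-- `p` has no (level or notch) features. -/
def Featureless (p : List Step) : Prop :=
  ∀ t : ℕ, ¬ HasLevelFeatureAt p t ∧ ¬ HasNotchFeatureAt p t

/-- Auxiliary function for `psi`, processing the path left to right while keeping track of
the current height `y - x` above the diagonal: at height `1`, a `D` step (a level feature)
is replaced by `E N` (a notch feature) and vice versa; all other steps are unchanged. -/
def psiAux : ℕ → List Step → List Step
  | 1, Step.D :: rest => Step.E :: Step.N :: psiAux 1 rest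
  | 1, Step.E :: Step.N :: rest => Step.D :: psiAux 1 rest
  | h, Step.N :: rest => Step.N :: psiAux (h + 1) rest
  | h, Step.E :: rest => Step.E :: psiAux (h - 1) rest
  | h, Step.D :: rest => Step.D :: psiAux h rest
  | _, [] => []
  termination_by h l => l.length

/-- `psi p` replaces every level feature of `p` by a notch feature at the same place and
vice versa, leaving all other steps unchanged. -/
def psi (p : List Step) : List Step := psiAux 0 p

/-- `a i`: the number of Schröder prefixes in `𝒟` terminating at `(i, i)`. -/
noncomputable def aSeq (i : ℕ) : ℕ :=
  Set.ncard {p : List Step | MemCalD p ∧ posX p = i ∧ posY p = i}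

/-- `b i`: the number of Schröder prefixes in `𝒟` terminating at `(i-1, i)` (and `b 0 = 0`). -/
noncomputable def bSeq (i : ℕ) : ℕ :=
  Set.ncard {p : List Step | MemCalD p ∧ posX p + 1 = i ∧ posY p = i}

/-- `c i`: the number of featureless Schröder prefixes in `𝒟` terminating at `(i, i)`. -/
noncomputable def cSeq (i : ℕ) : ℕ :=
  Set.ncard {p : List Step | MemCalD p ∧ Featureless p ∧ posX p = i ∧ posY p = i}

/-- `d i`: the number of featureless Schröder prefixes in `𝒟` terminating at `(i-1, i)`
(and `d 0 = 0`). -/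
noncomputable def dSeq (i : ℕ) : ℕ :=
  Set.ncard {p : List Step | MemCalD p ∧ Featureless p ∧ posX p + 1 = i ∧ posY p = i}

/-- The permutation `π` (of `{1, …, n}`, 0-indexed as `Fin n`) contains the pattern `τ`
(a permutation of `{1, …, k}`, 0-indexed as `Fin k`). -/
def Contains {n k : ℕ} (π : Equiv.Perm (Fin n)) (τ : Equiv.Perm (Fin k)) : Prop :=
  ∃ f : Fin k → Fin n, StrictMono f ∧ ∀ a b : Fin k, τ a < τ b ↔ π (f a) < π (f b)

/-- The permutation `π` avoids the pattern `τ`. -/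
def Avoids {n k : ℕ} (π : Equiv.Perm (Fin n)) (τ : Equiv.Perm (Fin k)) : Prop :=
  ¬ Contains π τ

/-- The reverse-complement of a permutation: `rc π (i) = (n+1) - π (n+1-i)` (1-indexed),
i.e. `rc π (i) = rev (π (rev i))` in 0-indexed form. -/
def rc {n : ℕ} (π : Equiv.Perm (Fin n)) : Equiv.Perm (Fin n) :=
  (Fin.revPerm.trans π).trans Fin.revPerm

/-- The pattern `1243` (0-indexed: `0 ↦ 0, 1 ↦ 1, 2 ↦ 3, 3 ↦ 2`). -/
def pat1243 : Equiv.Perm (Fin 4) := Equiv.swap 2 3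

/-- The pattern `2143` (0-indexed: `0 ↦ 1, 1 ↦ 0, 2 ↦ 3, 3 ↦ 2`). -/
def pat2143 : Equiv.Perm (Fin 4) := Equiv.swap 0 1 * Equiv.swap 2 3

/-- The pattern `2134` (0-indexed: `0 ↦ 1, 1 ↦ 0, 2 ↦ 2, 3 ↦ 3`). -/
def pat2134 : Equiv.Perm (Fin 4) := Equiv.swap 0 1

/-- `g m`: the number of centrosymmetric involutions of `{1, …, m}` avoiding
both `1243` and `2143`. -/
noncomputable def g (m : ℕ) : ℕ :=
  Set.ncard {π : Equiv.Perm (Fin m) |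
    π⁻¹ = π ∧ rc π = π ∧ Avoids π pat1243 ∧ Avoids π pat2143}


/-- violation-free: avoids 4312 and 3412 -/
def AvZ (τ : ℤ → ℤ) : Prop :=
  ∀ p q i j : ℤ, p < q → q < i → i < j → τ i < τ j → τ j < τ p → τ j < τ q → False

structure MemX (e L : ℤ) (τ : ℤ → ℤ) : Prop where
  inv : ∀ x, τ (τ x) = x
  sym : ∀ x, τ (e - x) = e - τ x
  supp : ∀ x, x < L → τ x = x
  av : AvZ τ

theorem MemX.supp' {e L : ℤ} {τ : ℤ → ℤ} (h : MemX e L τ) (x : ℤ) (hx : e - L < x) : τ x = x := by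
  have := h.sym x
  have h2 := h.supp (e - x) (by omega)
  omega

theorem MemX.ge {e L : ℤ} {τ : ℤ → ℤ} (h : MemX e L τ) (x : ℤ) (hx : L ≤ x) : L ≤ τ x := by
  by_contra hc
  have := h.supp (τ x) (by omega)
  have := h.inv x
  omega

theorem MemX.le {e L : ℤ} {τ : ℤ → ℤ} (h : MemX e L τ) (x : ℤ) (hx : x ≤ e - L) :
    τ x ≤ e - L := by
  by_contra hc
  have := h.supp' (τ x) (by omega)
  have := h.inv x
  omega

theorem MemX.inj {e L : ℤ} {τ : ℤ → ℤ} (h : MemX e L τ) {x y : ℤ} (hx : τ x = τ y) : x = y := by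
  rw [← h.inv x, ← h.inv y, hx]

theorem no_viol_in {ρ : ℤ → ℤ} {u v : ℤ}
    (h1 : ∀ x, u ≤ x → x ≤ v → u ≤ ρ x ∧ ρ x ≤ v)
    (h1' : ∀ x, (x < u ∨ v < x) → (ρ x < u ∨ v < ρ x))
    (h2 : ∀ x y, x < u → v < ρ x → y < u → v < ρ y → x = y)
    (h3 : ∀ x y, v < x → ρ x < u → v < y → ρ y < u → x = y)
    (h4 : ∀ q i j, u ≤ q → q < i → i < j → j ≤ v → ρ i < ρ j → ρ j < ρ q → False)
    {p q i j : ℤ} (hpq : p < q) (hqi : q < i) (hij : i < j) (a : ρ i < ρ j) (b : ρ j < ρ p)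
    (c : ρ j < ρ q) :
    (p < u ∨ v < p) ∧ (q < u ∨ v < q) ∧ (i < u ∨ v < i) ∧ (j < u ∨ v < j) := by
  have P : ∀ x, (u ≤ x ∧ x ≤ v ∧ u ≤ ρ x ∧ ρ x ≤ v) ∨
      ((x < u ∨ v < x) ∧ (ρ x < u ∨ v < ρ x)) := by
    intro x
    by_cases hx : u ≤ x ∧ x ≤ v
    · left; have := h1 x hx.1 hx.2; omega
    · right; have := h1' x (by omega); omega
  have hp := P p
  have hq := P q
  have hi := P i
  have hj := P j
  have A1 := h2 p q
  have A2 := h3 i j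
  have A3 : ¬ (u ≤ q ∧ q < i ∧ i < j ∧ j ≤ v ∧ ρ i < ρ j ∧ ρ j < ρ q) :=
    fun ⟨a1, a2, a3, a4, a5, a6⟩ => h4 q i j a1 a2 a3 a4 a5 a6
  omega

/-- replace τ on [u,v] by f and on the mirror by the mirrored f -/
def patch (e u v : ℤ) (f τ : ℤ → ℤ) (x : ℤ) : ℤ :=
  if u ≤ x ∧ x ≤ v then f x else if e - v ≤ x ∧ x ≤ e - u then e - f (e - x) else τ x

theorem patch_mem {e L L' u v : ℤ} {f τ : ℤ → ℤ} (h : MemX e L τ) (huv : u ≤ v)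
    (hc : u + v = e ∨ 2 * v < e) (hL : L' ≤ u) (hL'' : ∀ x, x < L' → τ x = x)
    (hp : ∀ x, u ≤ x → x ≤ v → u ≤ τ x ∧ τ x ≤ v)
    (hcov : ∀ x y, x < u → v < τ x → y < u → v < τ y → x = y)
    (f1 : ∀ x, u ≤ x → x ≤ v → u ≤ f x ∧ f x ≤ v)
    (f2 : ∀ x, u ≤ x → x ≤ v → f (f x) = x)
    (f3 : u + v = e → ∀ x, u ≤ x → x ≤ v → f (e - x) = e - f x)
    (f4 : ∀ q i j, u ≤ q → q < i → i < j → j ≤ v → f i < f j → f j < f q → False) :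
    MemX e L' (patch e u v f τ) := by
  have e1 : ∀ x, u ≤ x → x ≤ v → patch e u v f τ x = f x := by
    intro x h1 h2; simp [patch, h1, h2]
  have e2 : ∀ x, e - v ≤ x → x ≤ e - u → patch e u v f τ x = e - f (e - x) := by
    intro x h1 h2
    by_cases hx : u ≤ x ∧ x ≤ v
    · rw [e1 x hx.1 hx.2]
      have := f3 (by omega) x hx.1 hx.2
      omega
    · simp only [patch, if_neg hx, if_pos (And.intro h1 h2)]
  have e3 : ∀ x, (x < u ∨ v < x) → (x < e - v ∨ e - u < x) → patch e u v f τ x = τ x := by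
    intro x h1 h2
    simp only [patch]
    rw [if_neg (by omega), if_neg (by omega)]
  have hp' : ∀ x, e - v ≤ x → x ≤ e - u → e - v ≤ τ x ∧ τ x ≤ e - u := by
    intro x h1 h2
    have := hp (e - x) (by omega) (by omega)
    have := h.sym x
    omega
  have no : ∀ x, (x < u ∨ v < x) → (τ x < u ∨ v < τ x) := by
    intro x hx
    have := hp (τ x)
    have := h.inv x
    omega
  have no' : ∀ x, (x < e - v ∨ e - u < x) → (τ x < e - v ∨ e - u < τ x) := by
    intro x hx
    have := hp' (τ x)
    have := h.inv x
    omega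
  generalize hρ : patch e u v f τ = ρ at *
  have r1 : ∀ x, u ≤ x → x ≤ v → u ≤ ρ x ∧ ρ x ≤ v := by
    intro x a b; rw [e1 x a b]; exact f1 x a b
  have r2 : ∀ x, e - v ≤ x → x ≤ e - u → e - v ≤ ρ x ∧ ρ x ≤ e - u := by
    intro x a b; rw [e2 x a b]; have := f1 (e - x) (by omega) (by omega); omega
  have cases3 : ∀ x, (u ≤ x ∧ x ≤ v) ∨ (e - v ≤ x ∧ x ≤ e - u) ∨
      ((x < u ∨ v < x) ∧ (x < e - v ∨ e - u < x)) := by intro x; omega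
  have rno : ∀ x, (x < u ∨ v < x) → (ρ x < u ∨ v < ρ x) := by
    intro x hx
    rcases cases3 x with c | c | c
    · omega
    · have := r2 x c.1 c.2; omega
    · rw [e3 x c.1 c.2]; exact no x c.1
  have rno' : ∀ x, (x < e - v ∨ e - u < x) → (ρ x < e - v ∨ e - u < ρ x) := by
    intro x hx
    rcases cases3 x with c | c | c
    · have := r1 x c.1 c.2; omega
    · omega
    · rw [e3 x c.1 c.2]; exact no' x c.2
  have rcov : ∀ x, x < u → v < ρ x → x < u ∧ v < τ x := by
    intro x h1 h2
    rcases cases3 x with c | c | c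
    · omega
    · have := r2 x c.1 c.2; omega
    · rw [e3 x c.1 c.2] at h2; exact ⟨h1, h2⟩
  have rcov3 : ∀ x, v < x → ρ x < u → v < x ∧ τ x < u := by
    intro x h1 h2
    rcases cases3 x with c | c | c
    · omega
    · have := r2 x c.1 c.2; omega
    · rw [e3 x c.1 c.2] at h2; exact ⟨h1, h2⟩
  have rcov' : ∀ x, x < e - v → e - u < ρ x → x < e - v ∧ e - u < τ x := by
    intro x h1 h2
    rcases cases3 x with c | c | c
    · have := r1 x c.1 c.2; omega
    · omega
    · rw [e3 x c.1 c.2] at h2; exact ⟨h1, h2⟩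
  have rcov3' : ∀ x, e - u < x → ρ x < e - v → e - u < x ∧ τ x < e - v := by
    intro x h1 h2
    rcases cases3 x with c | c | c
    · have := r1 x c.1 c.2; omega
    · omega
    · rw [e3 x c.1 c.2] at h2; exact ⟨h1, h2⟩
  refine ⟨?_, ?_, ?_, ?_⟩
  · intro x
    rcases cases3 x with c | c | c
    · have := f1 x c.1 c.2
      rw [e1 x c.1 c.2, e1 _ this.1 this.2, f2 x c.1 c.2]
    · have := f1 (e - x) (by omega) (by omega)
      rw [e2 x c.1 c.2, e2 _ (by omega) (by omega), sub_sub_cancel,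
        f2 (e - x) (by omega) (by omega)]
      omega
    · rw [e3 x c.1 c.2, e3 _ (no x c.1) (no' x c.2), h.inv]
  · intro x
    rcases cases3 x with c | c | c
    · rw [e1 x c.1 c.2, e2 (e - x) (by omega) (by omega), sub_sub_cancel]
    · rw [e2 x c.1 c.2, e1 (e - x) (by omega) (by omega)]; omega
    · rw [e3 x c.1 c.2, e3 (e - x) (by omega) (by omega), h.sym]
  · intro x hx
    rw [e3 x (by omega) (by omega), hL'' x hx]
  · intro p q i j hpq hqi hij a b c
    have N1 := no_viol_in r1 rno
      (fun x y a1 a2 a3 a4 => hcov x y a1 (rcov x a1 a2).2 a3 (rcov y a3 a4).2)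
      (fun x y a1 a2 a3 a4 => by
        have := hcov (τ x) (τ y) (rcov3 x a1 a2).2 (by rw [h.inv]; exact a1)
          (rcov3 y a3 a4).2 (by rw [h.inv]; exact a3)
        exact h.inj this)
      (fun q i j a1 a2 a3 a4 a5 a6 => by
        rw [e1 i (by omega) (by omega), e1 j (by omega) (by omega)] at a5
        rw [e1 q (by omega) (by omega), e1 j (by omega) (by omega)] at a6
        exact f4 q i j a1 a2 a3 a4 a5 a6) hpq hqi hij a b c
    have N2 := no_viol_in r2 rno'
      (fun x y a1 a2 a3 a4 => by
        have b1 := (rcov' x a1 a2).2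
        have b2 := (rcov' y a3 a4).2
        have s1 := h.sym x
        have s2 := h.sym y
        have := hcov (τ (e - x)) (τ (e - y)) (by omega) (by rw [h.inv]; omega)
          (by omega) (by rw [h.inv]; omega)
        have := h.inj this
        omega)
      (fun x y a1 a2 a3 a4 => by
        have b1 := (rcov3' x a1 a2).2
        have b2 := (rcov3' y a3 a4).2
        have s1 := h.sym x
        have s2 := h.sym y
        have := hcov (e - x) (e - y) (by omega) (by omega)
          (by omega) (by omega)
        omega)
      (fun q i j a1 a2 a3 a4 a5 a6 => by
        rw [e2 i (by omega) (by omega), e2 j (by omega) (by omega)] at a5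
        rw [e2 q (by omega) (by omega), e2 j (by omega) (by omega)] at a6
        have g1 := f1 (e - q) (by omega) (by omega)
        have g2 := f1 (e - i) (by omega) (by omega)
        have g3 := f1 (e - j) (by omega) (by omega)
        have k1 := f2 (e - q) (by omega) (by omega)
        have k2 := f2 (e - i) (by omega) (by omega)
        have k3 := f2 (e - j) (by omega) (by omega)
        -- dots (f, position)
        refine f4 (f (e - q)) (f (e - j)) (f (e - i)) (by omega) (by omega) (by omega) (by omega)
          (by omega) (by omega)) hpq hqi hij a b c
    rw [e3 i (by omega) (by omega), e3 j (by omega) (by omega)] at a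
    rw [e3 p (by omega) (by omega), e3 j (by omega) (by omega)] at b
    rw [e3 q (by omega) (by omega), e3 j (by omega) (by omega)] at c
    exact h.av p q i j hpq hqi hij a b c

theorem rev_block {e L u a b : ℤ} {τ : ℤ → ℤ} (h : MemX e L τ) (hu : 0 < u) (h0 : τ 0 = b)
    (hua : τ u = a) (ha : u ≤ a) (hab : a < b) : ∀ x, u ≤ x → x ≤ a → τ x = u + a - x := by
  have hau : τ a = u := by rw [← hua, h.inv]
  have rng : ∀ x, u ≤ x → x ≤ a → u ≤ τ x ∧ τ x ≤ a := by
    intro x h1 h2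
    rcases eq_or_lt_of_le h1 with h1 | h1
    · subst h1; omega
    rcases eq_or_lt_of_le h2 with h2 | h2
    · subst h2; omega
    have hi := h.inv x
    constructor
    · by_contra hc
      exact h.av (τ x) u x a (by omega) h1 h2 (by omega) (by omega) (by omega)
    · by_contra hc
      exact h.av u x a (τ x) (by omega) h2 (by omega) (by omega) (by omega) (by omega)
  have dec : ∀ x y, u ≤ x → x < y → y ≤ a → τ y < τ x := by
    intro x y h1 h2 h3
    by_contra hc
    have hne : τ x ≠ τ y := fun hh => by have := h.inj hh; omega
    have r1 := rng y (by omega) h3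
    rcases eq_or_lt_of_le h1 with h1 | h1
    · subst h1; omega
    have hne2 : τ y ≠ τ u := fun hh => by have := h.inj hh; omega
    exact h.av 0 u x y hu h1 h2 (by omega) (by omega) (by omega)
  have up : ∀ n : ℕ, u + n ≤ a → τ (u + n) ≤ a - n := by
    intro n
    induction n with
    | zero => intro _; simp [hua]
    | succ n ih =>
      intro hn
      push_cast at hn ⊢
      have := ih (by omega)
      have := dec (u + n) (u + (n + 1)) (by omega) (by omega) (by omega)
      omega
  have dn : ∀ n : ℕ, u ≤ a - n → u + n ≤ τ (a - n) := by
    intro n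
    induction n with
    | zero => intro _; simp [hau]
    | succ n ih =>
      intro hn
      push_cast at hn ⊢
      have := ih (by omega)
      have := dec (a - (n + 1)) (a - n) (by omega) (by omega) (by omega)
      omega
  intro x h1 h2
  obtain ⟨n, hn⟩ := Int.eq_ofNat_of_zero_le (show 0 ≤ x - u by omega)
  obtain ⟨k, hk⟩ := Int.eq_ofNat_of_zero_le (show 0 ≤ a - x by omega)
  have A := up n (by omega)
  have B := dn k (by omega)
  rw [show u + (n : ℤ) = x by omega] at A
  rw [show a - (k : ℤ) = x by omega] at B
  omega

theorem mirror_block {e L u a : ℤ} {τ : ℤ → ℤ} (h : MemX e L τ)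
    (hua : τ u = a) (ha : u ≤ a) (hae : a ≤ e - u) : u + a = e ∨ 2 * a < e := by
  by_contra hc
  have hau : τ a = u := by rw [← hua, h.inv]
  have s1 := h.sym u
  have s2 := h.sym a
  by_cases h2 : 2 * a = e
  · rw [show e - a = a by omega] at s2
    omega
  · exact h.av u (e - a) a (e - u) (by omega) (by omega) (by omega) (by omega) (by omega) (by omega)

theorem patch_in {e u v : ℤ} {f τ : ℤ → ℤ} {x : ℤ} (h1 : u ≤ x) (h2 : x ≤ v) :
    patch e u v f τ x = f x := by simp [patch, h1, h2]

theorem patch_mirror {e u v : ℤ} {f τ : ℤ → ℤ} {x : ℤ} (h : x < u ∨ v < x) (h1 : e - v ≤ x)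
    (h2 : x ≤ e - u) :
    patch e u v f τ x = e - f (e - x) := by
  simp only [patch]; rw [if_neg (by omega), if_pos ⟨h1, h2⟩]

theorem patch_out {e u v : ℤ} {f τ : ℤ → ℤ} {x : ℤ} (h1 : x < u ∨ v < x)
    (h2 : x < e - v ∨ e - u < x) : patch e u v f τ x = τ x := by
  simp only [patch]; rw [if_neg (by omega), if_neg (by omega)]

/-! second class -/
theorem second_bij {e L : ℤ} (he : 2 * (L + 1) < e) :
    Set.BijOn (patch e L (L + 1) (fun x => x))
      {τ | MemX e L τ ∧ τ L = L + 1} {τ | MemX e (L + 2) τ} := by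
  have key : ∀ τ, MemX e L τ → τ L = L + 1 → τ (L + 1) = L ∧ τ (e - L) = e - (L + 1) ∧
      τ (e - (L + 1)) = e - L := by
    intro τ h h1
    have h2 : τ (L + 1) = L := by rw [← h1, h.inv]
    exact ⟨h2, by rw [h.sym, h1], by rw [h.sym, h2]⟩
  refine Set.InvOn.bijOn (f' := patch e L (L + 1) (fun x => 2 * L + 1 - x)) ⟨?_, ?_⟩ ?_ ?_
  · rintro τ ⟨h, h1⟩
    obtain ⟨h2, h3, h4⟩ := key τ h h1
    funext x
    by_cases c1 : L ≤ x ∧ x ≤ L + 1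
    · rw [patch_in c1.1 c1.2]
      rcases (show x = L ∨ x = L + 1 by omega) with c | c <;> subst c <;> omega
    · by_cases c2 : e - (L + 1) ≤ x ∧ x ≤ e - L
      · rw [patch_mirror (by omega) c2.1 c2.2]
        rcases (show x = e - L ∨ x = e - (L + 1) by omega) with c | c <;> subst c <;> omega
      · rw [patch_out (by omega) (by omega), patch_out (by omega) (by omega)]
  · rintro τ h
    have h : MemX e (L + 2) τ := h
    funext x
    by_cases c1 : L ≤ x ∧ x ≤ L + 1
    · rw [patch_in c1.1 c1.2, h.supp x (by omega)]
    · by_cases c2 : e - (L + 1) ≤ x ∧ x ≤ e - L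
      · rw [patch_mirror (by omega) c2.1 c2.2, h.supp' x (by omega)]; omega
      · rw [patch_out (by omega) (by omega), patch_out (by omega) (by omega)]
  · rintro τ ⟨h, h1⟩
    obtain ⟨h2, h3, h4⟩ := key τ h h1
    have M : MemX e L (patch e L (L + 1) (fun x => x) τ) := by
      refine patch_mem h (by omega) (by omega) (by omega) h.supp ?_ ?_ (by intros; omega)
        (by intros; omega) (by intros; omega) (by intros; omega)
      · intro x a b
        rcases (show x = L ∨ x = L + 1 by omega) with c | c <;> subst c <;> omega
      · intro x y a b
        have := h.supp x a
        omega
    refine ⟨M.inv, M.sym, ?_, M.av⟩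
    intro x hx
    by_cases c : x < L
    · exact M.supp x c
    · rw [patch_in (by omega) (by omega)]
  · rintro τ h
    have h : MemX e (L + 2) τ := h
    refine ⟨patch_mem h (by omega) (by omega) (by omega) (fun x hx => h.supp x (by omega)) ?_ ?_
      (by intros; omega)
        (by intros; omega) (by intros; omega) (by intros; omega), ?_⟩
    · intro x a b
      rw [h.supp x (by omega)]; omega
    · intro x y a b
      have := h.supp x (by omega)
      omega
    · rw [patch_in (by omega) (by omega)]; omega

/-! merge -/
def Fmap (e : ℤ) (τ : ℤ → ℤ) : ℤ → ℤ :=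
  patch e 1 (τ 1) (fun x => if x = 1 then 1 else if x = e - 1 then e - 1 else
    (if τ 1 = e - 1 then e - 2 else τ 1) + 2 - x) τ

def Gmap (e : ℤ) (τ : ℤ → ℤ) : ℤ → ℤ :=
  patch e 1 (if τ 2 = e - 2 then e - 1 else τ 2)
    (fun x => 1 + (if τ 2 = e - 2 then e - 1 else τ 2) - x) τ

theorem strB {e : ℤ} {τ : ℤ → ℤ} (he : 5 ≤ e) (h : MemX e 0 τ) (h0 : 2 ≤ τ 0) (h1 : τ 1 ≠ 1) :
    2 ≤ τ 1 ∧ τ 1 < τ 0 ∧ τ 0 ≤ e ∧ (1 + τ 1 = e ∨ 2 * τ 1 < e) ∧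
      ∀ x, 1 ≤ x → x ≤ τ 1 → τ x = 1 + τ 1 - x := by
  have i0 := h.inv 0
  have i1 := h.inv 1
  have a1 : 2 ≤ τ 1 := by
    have := h.ge 1 (by omega)
    by_contra hc
    have : τ 1 = 0 := by omega
    rw [this] at i1; omega
  have a2 : τ 1 < τ 0 := by
    by_contra hc
    have : τ 1 ≠ τ 0 := fun hh => by have := h.inj hh; omega
    exact h.av 0 1 (τ 0) (τ 1) (by omega) (by omega) (by omega) (by omega) (by omega) (by omega)
  have a3 := h.le 0 (by omega)
  exact ⟨a1, a2, by omega, mirror_block h rfl (by omega) (by omega),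
    rev_block h (by omega) rfl rfl (by omega) a2⟩

theorem strA {e : ℤ} {τ : ℤ → ℤ} (he : 5 ≤ e) (h : MemX e 0 τ) (h0 : 3 ≤ τ 0) (h1 : τ 1 = 1) :
    2 ≤ τ 2 ∧ τ 2 < τ 0 ∧ τ 0 ≤ e ∧ τ 0 ≠ e - 1 ∧ τ (e - 1) = e - 1 ∧
      (2 + τ 2 = e ∨ 2 * τ 2 < e) ∧
      ∀ x, 2 ≤ x → x ≤ τ 2 → τ x = 2 + τ 2 - x := by
  have i0 := h.inv 0
  have i2 := h.inv 2
  have s1 := h.sym 1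
  have a1 : 2 ≤ τ 2 := by
    have := h.ge 2 (by omega)
    by_contra hc
    rcases (show τ 2 = 0 ∨ τ 2 = 1 by omega) with c | c
    · rw [c] at i2; omega
    · rw [c] at i2; omega
  have a2 : τ 2 < τ 0 := by
    by_contra hc
    have : τ 2 ≠ τ 0 := fun hh => by have := h.inj hh; omega
    exact h.av 0 2 (τ 0) (τ 2) (by omega) (by omega) (by omega) (by omega) (by omega) (by omega)
  have a3 := h.le 0 (by omega)
  have a4 : τ 0 ≠ e - 1 := fun hh => by
    rw [hh] at i0; omega
  have a5 : τ 2 ≠ e - 1 := fun hh => by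
    rw [hh] at i2; omega
  exact ⟨a1, a2, by omega, a4, by omega, mirror_block h rfl (by omega) (by omega),
    rev_block h (by omega) rfl rfl (by omega) a2⟩

theorem F_maps {e : ℤ} (he : 5 ≤ e) {τ : ℤ → ℤ} (h : MemX e 0 τ) (h0 : 2 ≤ τ 0) (h1 : τ 1 ≠ 1) :
    MemX e 0 (Fmap e τ) ∧ 3 ≤ Fmap e τ 0 ∧ Fmap e τ 1 = 1 := by
  obtain ⟨a1, a2, a3, a4, a5⟩ := strB he h h0 h1
  refine ⟨?_, ?_, ?_⟩
  · refine patch_mem h (by omega) (by omega) (by omega) h.supp ?_ ?_ ?_ ?_ ?_ ?_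
    · intro x p q
      rw [a5 x p q]; omega
    · intro x y p q r s
      have := h.supp x
      have := h.supp y
      omega
    · intro x p q
      split_ifs <;> omega
    · intro x p q
      split_ifs <;> omega
    · intro hh x p q
      split_ifs <;> omega
    · intro q i j p1 p2 p3 p4 
      split_ifs <;> omega
  · unfold Fmap
    rw [patch_out (by omega) (by omega)]; omega
  · unfold Fmap
    rw [patch_in (by omega) (by omega)]; simp

theorem G_maps {e : ℤ} (he : 5 ≤ e) {τ : ℤ → ℤ} (h : MemX e 0 τ) (h0 : 3 ≤ τ 0) (h1 : τ 1 = 1) :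
    MemX e 0 (Gmap e τ) ∧ 2 ≤ Gmap e τ 0 ∧ Gmap e τ 1 ≠ 1 := by
  obtain ⟨a1, a2, a3, a4, a5, a6, a7⟩ := strA he h h0 h1
  unfold Gmap
  generalize ha' : (if τ 2 = e - 2 then e - 1 else τ 2) = a'
  have ha : (τ 2 = e - 2 ∧ a' = e - 1) ∨ (τ 2 = a' ∧ 2 * a' < e) := by
    split_ifs at ha' <;> omega
  refine ⟨?_, ?_, ?_⟩
  · refine patch_mem h (by omega) (by omega) (by omega) h.supp ?_ ?_ (by intros; omega)
      (by intros; omega) (by intros; omega) (by intros; omega)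
    · intro x p q
      by_cases c1 : x = 1
      · subst c1; omega
      by_cases c2 : x = e - 1
      · subst c2; omega
      rw [a7 x (by omega) (by omega)]; omega
    · intro x y p q r s
      have := h.supp x
      have := h.supp y
      omega
  · rw [patch_out (by omega) (by omega)]; omega
  · rw [patch_in (by omega) (by omega)]; omega

theorem merge_bij {e : ℤ} (he : 5 ≤ e) :
    Set.BijOn (Fmap e) {τ | MemX e 0 τ ∧ 2 ≤ τ 0 ∧ τ 1 ≠ 1}
      {τ | MemX e 0 τ ∧ 3 ≤ τ 0 ∧ τ 1 = 1} := by
  refine Set.InvOn.bijOn (f' := Gmap e) ⟨?_, ?_⟩ ?_ ?_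
  · rintro τ ⟨h, h0, h1⟩
    obtain ⟨a1, a2, a3, a4, a5⟩ := strB he h h0 h1
    have v2 : Fmap e τ 2 = if τ 1 = e - 1 then e - 2 else τ 1 := by
      unfold Fmap
      rw [patch_in (by omega) (by omega)]
      split_ifs <;> omega
    have v3 : (if Fmap e τ 2 = e - 2 then e - 1 else Fmap e τ 2) = τ 1 := by
      rw [v2]; split_ifs <;> omega
    unfold Gmap
    rw [v3]
    funext x
    by_cases c1 : 1 ≤ x ∧ x ≤ τ 1
    · rw [patch_in c1.1 c1.2, a5 x c1.1 c1.2]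
    · by_cases c2 : e - τ 1 ≤ x ∧ x ≤ e - 1
      · rw [patch_mirror (by omega) c2.1 c2.2]
        have := a5 (e - x) (by omega) (by omega)
        have := h.sym x
        omega
      · unfold Fmap
        rw [patch_out (by omega) (by omega), patch_out (by omega) (by omega)]
  · rintro τ ⟨h, h0, h1⟩
    obtain ⟨a1, a2, a3, a4, a5, a6, a7⟩ := strA he h h0 h1
    have v1 : Gmap e τ 1 = if τ 2 = e - 2 then e - 1 else τ 2 := by
      unfold Gmap
      rw [patch_in (by omega) (by split_ifs <;> omega)]
      omega
    have v2 : (if Gmap e τ 1 = e - 1 then e - 2 else Gmap e τ 1) = τ 2 := by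
      rw [v1]; split_ifs <;> omega
    unfold Fmap
    rw [v2, v1]
    unfold Gmap
    generalize ha' : (if τ 2 = e - 2 then e - 1 else τ 2) = a'
    have ha : (τ 2 = e - 2 ∧ a' = e - 1) ∨ (τ 2 = a' ∧ 2 * a' < e) := by
      split_ifs at ha' <;> omega
    have val : ∀ x, 1 ≤ x → x ≤ a' →
        (if x = 1 then 1 else if x = e - 1 then e - 1 else τ 2 + 2 - x) = τ x := by
      intro x p q
      by_cases c1 : x = 1
      · subst c1; simp [h1]
      by_cases c2 : x = e - 1
      · subst c2; simp [c1, a5]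
      rw [a7 x (by omega) (by omega), if_neg c1, if_neg c2]; omega
    funext x
    by_cases c1 : 1 ≤ x ∧ x ≤ a'
    · rw [patch_in c1.1 c1.2, val x c1.1 c1.2]
    · by_cases c2 : e - a' ≤ x ∧ x ≤ e - 1
      · rw [patch_mirror (by omega) c2.1 c2.2]
        have := val (e - x) (by omega) (by omega)
        have := h.sym x
        omega
      · rw [patch_out (by omega) (by omega), patch_out (by omega) (by omega)]
  · rintro τ ⟨h, h0, h1⟩
    exact F_maps he h h0 h1
  · rintro τ ⟨h, h0, h1⟩
    exact G_maps he h h0 h1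

/-! conjugation -/
def sw (e x : ℤ) : ℤ :=
  if x = 0 then 1 else if x = 1 then 0 else if x = e then e - 1 else if x = e - 1 then e else x

theorem sw_spec {e : ℤ} (he : 5 ≤ e) (x : ℤ) :
    (x = 0 ∧ sw e x = 1) ∨ (x = 1 ∧ sw e x = 0) ∨ (x = e ∧ sw e x = e - 1) ∨
    (x = e - 1 ∧ sw e x = e) ∨ (x ≠ 0 ∧ x ≠ 1 ∧ x ≠ e ∧ x ≠ e - 1 ∧ sw e x = x) := by
  unfold sw; split_ifs <;> omega

theorem sw_sw {e : ℤ} (he : 5 ≤ e) (x : ℤ) : sw e (sw e x) = x := by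
  have := sw_spec he x
  have := sw_spec he (sw e x)
  omega

theorem sw_sym {e : ℤ} (he : 5 ≤ e) (x : ℤ) : sw e (e - x) = e - sw e x := by
  have := sw_spec he x
  have := sw_spec he (e - x)
  omega

def cj (e : ℤ) (τ : ℤ → ℤ) (x : ℤ) : ℤ := sw e (τ (sw e x))

theorem cj_maps {e c : ℤ} (he : 5 ≤ e) (hc : 2 ≤ c) (hc' : c ≤ 3) {τ : ℤ → ℤ} (h : MemX e 0 τ)
    (h0 : c ≤ τ 0) (h1 : τ 1 = 1) : MemX e 1 (cj e τ) ∧ c ≤ cj e τ 1 := by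
  have s1 := h.sym 1
  have c0 : cj e τ 0 = 0 := by simp [cj, sw, h1]
  have inv : ∀ x, cj e τ (cj e τ x) = x := by
    intro x; simp only [cj]; rw [sw_sw he, h.inv, sw_sw he]
  have sym : ∀ x, cj e τ (e - x) = e - cj e τ x := by
    intro x; simp only [cj]; rw [sw_sym he, h.sym, sw_sym he]
  have supp : ∀ x, x < 1 → cj e τ x = x := by
    intro x hx
    by_cases hx0 : x = 0
    · rw [hx0, c0]
    · have := sw_spec he x
      simp only [cj]
      rw [show sw e x = x by omega, h.supp x (by omega)]; omega
  refine ⟨⟨inv, sym, supp, ?_⟩, ?_⟩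
  · have supp' : ∀ x, e - 1 < x → cj e τ x = x := by
      intro x hx
      have := sym x
      have := supp (e - x) (by omega)
      omega
    intro p q i j hpq hqi hij a b d
    have facts : ∀ y, (y ≤ 0 ∧ cj e τ y = y) ∨ (e ≤ y ∧ cj e τ y = y) ∨
        (0 < y ∧ y < e ∧ 0 < cj e τ y ∧ cj e τ y < e) := by
      intro y
      by_cases y1 : y ≤ 0
      · left; exact ⟨y1, supp y (by omega)⟩
      by_cases y2 : e ≤ y
      · right; left; exact ⟨y2, supp' y (by omega)⟩
      have i := inv y
      have k1 := supp (cj e τ y)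
      have k2 := supp' (cj e τ y)
      omega
    have fp := facts p
    have fq := facts q
    have fi := facts i
    have fj := facts j
    have vp : τ (sw e p) = sw e (cj e τ p) := by simp only [cj]; rw [sw_sw he]
    have vq : τ (sw e q) = sw e (cj e τ q) := by simp only [cj]; rw [sw_sw he]
    have vi : τ (sw e i) = sw e (cj e τ i) := by simp only [cj]; rw [sw_sw he]
    have vj : τ (sw e j) = sw e (cj e τ j) := by simp only [cj]; rw [sw_sw he]
    have mono : ∀ x y, 0 < x → x < y → y < e → sw e x < sw e y := by
      intro x y _ _ _
      have := sw_spec he x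
      have := sw_spec he y
      omega
    refine h.av (sw e p) (sw e q) (sw e i) (sw e j) (mono _ _ ?_ hpq ?_) (mono _ _ ?_ hqi ?_)
      (mono _ _ ?_ hij ?_) ?_ ?_ ?_
    any_goals omega
    · rw [vi, vj]; exact mono _ _ (by omega) a (by omega)
    · rw [vp, vj]; exact mono _ _ (by omega) b (by omega)
    · rw [vq, vj]; exact mono _ _ (by omega) d (by omega)
  · have : cj e τ 1 = sw e (τ 0) := by simp [cj, sw]
    rw [this]
    have := sw_spec he (τ 0)
    omega

theorem aux_range {e p q i j P Q I J : ℤ} (hpq : p < q) (hqi : q < i) (hij : i < j) (a : I < J)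
    (b : J < P) (d : J < Q) (hne : P ≠ Q)
    (fp : (p < 0 ∧ P = p) ∨ (e < p ∧ P = p) ∨ (0 ≤ p ∧ p ≤ e ∧ 0 ≤ P ∧ P ≤ e))
    (fq : (q < 0 ∧ Q = q) ∨ (e < q ∧ Q = q) ∨ (0 ≤ q ∧ q ≤ e ∧ 0 ≤ Q ∧ Q ≤ e))
    (fi : (i < 0 ∧ I = i) ∨ (e < i ∧ I = i) ∨ (0 ≤ i ∧ i ≤ e ∧ 0 ≤ I ∧ I ≤ e))
    (fj : (j < 0 ∧ J = j) ∨ (e < j ∧ J = j) ∨ (0 ≤ j ∧ j ≤ e ∧ 0 ≤ J ∧ J ≤ e)) :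
    (0 ≤ p ∧ p ≤ e ∧ 0 ≤ P ∧ P ≤ e) ∧ (0 ≤ q ∧ q ≤ e ∧ 0 ≤ Q ∧ Q ≤ e) ∧
    (0 ≤ i ∧ i ≤ e ∧ 0 ≤ I ∧ I ≤ e) ∧ (0 ≤ j ∧ j ≤ e ∧ 0 ≤ J ∧ J ≤ e) ∧ P ≠ Q ∧ I < J := by
  omega

theorem cj_maps' {e c : ℤ} (he : 5 ≤ e) (hc : 2 ≤ c) (hc' : c ≤ 3) {τ : ℤ → ℤ} (h : MemX e 1 τ)
    (h0 : c ≤ τ 1) : MemX e 0 (cj e τ) ∧ c ≤ cj e τ 0 ∧ cj e τ 1 = 1 := by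
  have t0 := h.supp 0 (by omega)
  have c1 : cj e τ 1 = 1 := by simp [cj, sw, t0]
  have inv : ∀ x, cj e τ (cj e τ x) = x := by
    intro x; simp only [cj]; rw [sw_sw he, h.inv, sw_sw he]
  have sym : ∀ x, cj e τ (e - x) = e - cj e τ x := by
    intro x; simp only [cj]; rw [sw_sym he, h.sym, sw_sym he]
  have supp : ∀ x, x < 0 → cj e τ x = x := by
    intro x hx
    have := sw_spec he x
    simp only [cj]
    rw [show sw e x = x by omega, h.supp x (by omega)]; omega
  refine ⟨⟨inv, sym, supp, ?_⟩, ?_, c1⟩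
  · have supp' : ∀ x, e < x → cj e τ x = x := by
      intro x hx
      have := sym x
      have := supp (e - x) (by omega)
      omega
    have c1' : cj e τ (e - 1) = e - 1 := by rw [sym, c1]
    have facts : ∀ y, (y < 0 ∧ cj e τ y = y) ∨ (e < y ∧ cj e τ y = y) ∨
        (0 ≤ y ∧ y ≤ e ∧ 0 ≤ cj e τ y ∧ cj e τ y ≤ e) := by
      intro y
      by_cases y1 : y < 0
      · left; exact ⟨y1, supp y (by omega)⟩
      by_cases y2 : e < y
      · right; left; exact ⟨y2, supp' y (by omega)⟩
      have i := inv y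
      have k1 := supp (cj e τ y)
      have k2 := supp' (cj e τ y)
      omega
    have facts1 : ∀ y, (y = 1 ∧ cj e τ y = 1) ∨ (y ≠ 1 ∧ cj e τ y ≠ 1) := by
      intro y
      by_cases y3 : y = 1
      · subst y3; omega
      · right; refine ⟨y3, fun hh => y3 ?_⟩
        rw [← inv y, hh, c1]
    have facts2 : ∀ y, (y = e - 1 ∧ cj e τ y = e - 1) ∨ (y ≠ e - 1 ∧ cj e τ y ≠ e - 1) := by
      intro y
      by_cases y3 : y = e - 1
      · subst y3; omega
      · right; refine ⟨y3, fun hh => y3 ?_⟩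
        rw [← inv y, hh, c1']
    intro p q i j hpq hqi hij a b d
    have hne : cj e τ p ≠ cj e τ q := fun hh => by
      have := inv p
      have := inv q
      rw [hh] at *
      omega
    have fp := facts p
    have fq := facts q
    have fi := facts i
    have fj := facts j
    have vp : τ (sw e p) = sw e (cj e τ p) := by simp only [cj]; rw [sw_sw he]
    have vq : τ (sw e q) = sw e (cj e τ q) := by simp only [cj]; rw [sw_sw he]
    have vi : τ (sw e i) = sw e (cj e τ i) := by simp only [cj]; rw [sw_sw he]
    have vj : τ (sw e j) = sw e (cj e τ j) := by simp only [cj]; rw [sw_sw he]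
    have mono : ∀ x y, 0 ≤ x → x < y → y ≤ e → x ≠ 1 → x ≠ e - 1 → y ≠ 1 → y ≠ e - 1 →
        sw e x < sw e y := by
      intro x y _ _ _ _ _ _ _
      have := sw_spec he x
      have := sw_spec he y
      omega
    have hne' : cj e τ i ≠ cj e τ j := by omega
    obtain ⟨gp, gq, gi, gj, r1, r2⟩ := aux_range hpq hqi hij a b d hne fp fq fi fj
    have hp1 := facts1 p
    have hq1 := facts1 q
    have hi1 := facts1 i
    have hj1 := facts1 j
    have hp2 := facts2 p
    have hq2 := facts2 q
    have hi2 := facts2 i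
    have hj2 := facts2 j
    clear fp fq fi fj facts facts1 facts2
    have np : p ≠ 1 ∧ cj e τ p ≠ 1 := by omega
    have nq : q ≠ 1 ∧ cj e τ q ≠ 1 := by omega
    have ni : i ≠ 1 ∧ cj e τ i ≠ 1 := by omega
    have nj : j ≠ 1 ∧ cj e τ j ≠ 1 := by omega
    clear hp1 hq1 hi1 hj1
    have np : p ≠ e - 1 ∧ cj e τ p ≠ e - 1 := by omega
    have nq : q ≠ e - 1 ∧ cj e τ q ≠ e - 1 := by omega
    have ni : i ≠ e - 1 ∧ cj e τ i ≠ e - 1 := by omega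
    have nj : j ≠ e - 1 ∧ cj e τ j ≠ e - 1 := by omega
    clear hp2 hq2 hi2 hj2
    refine h.av (sw e p) (sw e q) (sw e i) (sw e j) (mono _ _ ?_ hpq ?_ ?_ ?_ ?_ ?_)
      (mono _ _ ?_ hqi ?_ ?_ ?_ ?_ ?_)
      (mono _ _ ?_ hij ?_ ?_ ?_ ?_ ?_) ?_ ?_ ?_
    any_goals omega
    · rw [vi, vj]; apply mono <;> omega
    · rw [vp, vj]; apply mono <;> omega
    · rw [vq, vj]; apply mono <;> omega
  · have : cj e τ 0 = sw e (τ 1) := by simp [cj, sw]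
    rw [this]
    have := sw_spec he (τ 1)
    omega

theorem cj_bij {e c : ℤ} (he : 5 ≤ e) (hc : 2 ≤ c) (hc' : c ≤ 3) :
    Set.BijOn (cj e) {τ | MemX e 0 τ ∧ c ≤ τ 0 ∧ τ 1 = 1} {τ | MemX e 1 τ ∧ c ≤ τ 1} := by
  have inv : ∀ τ : ℤ → ℤ, cj e (cj e τ) = τ := by
    intro τ; funext x; simp only [cj]; rw [sw_sw he, sw_sw he]
  exact Set.InvOn.bijOn (f' := cj e) ⟨fun τ _ => inv τ, fun τ _ => inv τ⟩
    (fun τ ⟨h, h0, h1⟩ => cj_maps he hc hc' h h0 h1) (fun τ ⟨h, h0⟩ => cj_maps' he hc hc' h h0)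

theorem ncard_bij {α β : Type*} {s : Set α} {t : Set β} {f : α → β} (h : Set.BijOn f s t) :
    s.ncard = t.ncard := by
  rw [← h.image_eq, h.injOn.ncard_image]

theorem split_first {e L : ℤ} (hfin : {τ | MemX e L τ}.Finite) (hL : 2 * L ≤ e) :
    {τ | MemX e L τ}.ncard = {τ | MemX e (L + 1) τ}.ncard + {τ | MemX e L τ ∧ L + 1 ≤ τ L}.ncard := by
  rw [← Set.ncard_union_eq ?_ ?_ ?_]
  · congr 1
    ext τ
    constructor
    · intro h
      have h : MemX e L τ := h
      by_cases c : τ L = L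
      · left
        refine ⟨h.inv, h.sym, ?_, h.av⟩
        intro x hx
        by_cases c2 : x = L
        · rw [c2, c]
        · exact h.supp x (by omega)
      · right
        exact ⟨h, by have := h.ge L le_rfl; omega⟩
    · rintro (h | h)
      · exact ⟨h.inv, h.sym, fun x hx => h.supp x (by omega), h.av⟩
      · exact h.1
  · rw [Set.disjoint_left]
    rintro τ h ⟨_, h2⟩
    have := MemX.supp h L (by omega)
    omega
  · exact hfin.subset fun τ h => ⟨h.inv, h.sym, fun x hx => h.supp x (by omega), h.av⟩
  · exact hfin.subset fun τ h => h.1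

theorem split_second {e L : ℤ} (hfin : {τ | MemX e L τ}.Finite) (hL : 2 * (L + 1) < e) :
    {τ | MemX e L τ ∧ L + 1 ≤ τ L}.ncard =
      {τ | MemX e (L + 2) τ}.ncard + {τ | MemX e L τ ∧ L + 2 ≤ τ L}.ncard := by
  rw [← ncard_bij (second_bij hL), ← Set.ncard_union_eq ?_ ?_ ?_]
  · congr 1
    ext τ
    simp only [Set.mem_ofPred_eq, Set.mem_union, ← and_or_left, and_congr_right_iff]
    intro _
    omega
  · rw [Set.disjoint_left]
    rintro τ ⟨_, h1⟩ ⟨_, h2⟩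
    omega
  · exact hfin.subset fun τ h => h.1
  · exact hfin.subset fun τ h => h.1

theorem split_third {e : ℤ} (he : 5 ≤ e) (hfin : {τ | MemX e 0 τ}.Finite) :
    {τ | MemX e 0 τ ∧ 2 ≤ τ 0}.ncard =
      {τ | MemX e 1 τ ∧ 2 ≤ τ 1}.ncard + {τ | MemX e 1 τ ∧ 3 ≤ τ 1}.ncard := by
  rw [← ncard_bij (cj_bij he (c := 2) (by omega) (by omega)),
    ← ncard_bij (cj_bij he (c := 3) (by omega) (by omega)), ← ncard_bij (merge_bij he),
    ← Set.ncard_union_eq ?_ ?_ ?_]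
  · congr 1
    ext τ
    simp only [Set.mem_ofPred_eq, Set.mem_union]
    tauto
  · rw [Set.disjoint_left]
    rintro τ ⟨_, _, h1⟩ ⟨_, _, h2⟩
    omega
  · exact hfin.subset fun τ h => h.1
  · exact hfin.subset fun τ h => h.1

theorem rec_X {e : ℤ} (he : 5 ≤ e) (hfin : {τ | MemX e 0 τ}.Finite) :
    {τ | MemX e 0 τ}.ncard + {τ | MemX e 2 τ}.ncard + {τ | MemX e 3 τ}.ncard =
      3 * {τ | MemX e 1 τ}.ncard := by
  have hfin1 : {τ | MemX e 1 τ}.Finite :=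
    hfin.subset fun τ h => ⟨h.inv, h.sym, fun x hx => h.supp x (by omega), h.av⟩
  have A := split_first hfin (by omega)
  have B := split_second hfin (by omega)
  have C := split_third he hfin
  have D := split_first hfin1 (by omega)
  have E := split_second hfin1 (by omega)
  norm_num at A B C D E
  omega

def Good (k : ℕ) (π : Equiv.Perm (Fin k)) : Prop :=
  (∀ i, π (π i) = i) ∧ (∀ i, π (Fin.rev i) = Fin.rev (π i)) ∧
    ∀ p q i j : Fin k, p < q → q < i → i < j → ¬ (π j < π i ∧ π p < π j ∧ π q < π j)

instance (k : ℕ) (π : Equiv.Perm (Fin k)) : Decidable (Good k π) := by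
  unfold Good; infer_instance

theorem good_iff (k : ℕ) (π : Equiv.Perm (Fin k)) :
    (π⁻¹ = π ∧ rc π = π ∧ Avoids π pat1243 ∧ Avoids π pat2143) ↔ Good k π := by
  have h1 : π⁻¹ = π ↔ ∀ i, π (π i) = i := by
    constructor
    · intro h i
      conv_lhs => rw [← h]
      rw [h]
      nth_rewrite 1 [← h]
      simp
    · intro h
      ext i
      rw [Equiv.Perm.inv_eq_iff_eq.mpr (h i).symm]
  have h2 : rc π = π ↔ ∀ i, π (Fin.rev i) = Fin.rev (π i) := by
    constructor
    · intro h i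
      have : rc π i = π i := by rw [h]
      simp only [rc, Equiv.trans_apply, Fin.revPerm_apply] at this
      rw [← this, Fin.rev_rev]
    · intro h
      apply Equiv.ext
      intro i
      simp only [rc, Equiv.trans_apply, Fin.revPerm_apply]
      rw [h, Fin.rev_rev]
  have h3 : (Avoids π pat1243 ∧ Avoids π pat2143) ↔
      ∀ p q i j : Fin k, p < q → q < i → i < j → ¬ (π j < π i ∧ π p < π j ∧ π q < π j) := by
    constructor
    · rintro ⟨hA, hB⟩ p q i j hpq hqi hij ⟨c1, c2, c3⟩
      have hm : StrictMono (![p, q, i, j] : Fin 4 → Fin k) := by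
        rw [Fin.strictMono_iff_lt_succ]
        intro x
        fin_cases x <;> simpa
      rcases lt_trichotomy (π p) (π q) with h | h | h
      · apply hA
        refine ⟨_, hm, ?_⟩
        intro a b
        fin_cases a <;> fin_cases b <;> simp [pat1243, Equiv.swap_apply_def] <;> order
      · have := π.injective h
        exact absurd this hpq.ne
      · apply hB
        refine ⟨_, hm, ?_⟩
        intro a b
        fin_cases a <;> fin_cases b <;> simp [pat2143, Equiv.swap_apply_def] <;> order
    · intro h
      constructor
      · rintro ⟨f, hm, hf⟩
        exact h (f 0) (f 1) (f 2) (f 3) (hm (by decide)) (hm (by decide)) (hm (by decide))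
          ⟨(hf 3 2).1 (by decide), (hf 0 3).1 (by decide), (hf 1 3).1 (by decide)⟩
      · rintro ⟨f, hm, hf⟩
        exact h (f 0) (f 1) (f 2) (f 3) (hm (by decide)) (hm (by decide)) (hm (by decide))
          ⟨(hf 3 2).1 (by decide), (hf 0 3).1 (by decide), (hf 1 3).1 (by decide)⟩
  rw [h1, h2, h3, Good]

theorem g_eq (k : ℕ) : g k = {π : Equiv.Perm (Fin k) | Good k π}.ncard := by
  unfold g
  congr 1
  ext π
  exact good_iff k π

theorem g_eq_card (k : ℕ) : g k = (Finset.univ.filter (Good k)).card := by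
  rw [g_eq, ← Set.ncard_coe_finset]
  congr 1
  ext π
  simp

theorem g0 : g 0 = 1 := by rw [g_eq_card]; decide +kernel
theorem g1 : g 1 = 1 := by rw [g_eq_card]; decide +kernel
theorem g2 : g 2 = 2 := by rw [g_eq_card]; decide +kernel
theorem g3 : g 3 = 2 := by rw [g_eq_card]; decide +kernel
theorem g4 : g 4 = 5 := by rw [g_eq_card]; decide +kernel
theorem g5 : g 5 = 5 := by rw [g_eq_card]; decide +kernel

/-- transport to the integers -/
def Phi (e L : ℤ) (k : ℕ) (π : Equiv.Perm (Fin k)) (x : ℤ) : ℤ :=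
  if h : L ≤ x ∧ x < L + k then e - L - (π ⟨(x - L).toNat, by omega⟩ : ℕ) else x

theorem Phi_in {e L : ℤ} {k : ℕ} (π : Equiv.Perm (Fin k)) (i : Fin k) :
    Phi e L k π (L + (i : ℕ)) = e - L - (π i : ℕ) := by
  have := i.2
  unfold Phi
  rw [dif_pos (by omega)]
  congr 4
  ext
  simp

theorem Phi_out {e L : ℤ} {k : ℕ} (π : Equiv.Perm (Fin k)) (x : ℤ) (h : x < L ∨ L + k ≤ x) :
    Phi e L k π x = x := by
  unfold Phi
  rw [dif_neg (by omega)]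

theorem cases_x (L : ℤ) (k : ℕ) (x : ℤ) :
    (∃ i : Fin k, x = L + (i : ℕ)) ∨ (x < L ∨ L + k ≤ x) := by
  by_cases h : x < L ∨ L + k ≤ x
  · exact Or.inr h
  · left
    exact ⟨⟨(x - L).toNat, by omega⟩, by simp only; omega⟩

theorem Phi_mem {e L : ℤ} {k : ℕ} (hk : e + 1 = 2 * L + k) {π : Equiv.Perm (Fin k)}
    (h : Good k π) : MemX e L (Phi e L k π) := by
  obtain ⟨h1, h2, h3⟩ := h
  have hrev : ∀ i : Fin k, e - L - ((i : ℕ) : ℤ) = L + ((Fin.rev i : Fin k) : ℕ) := by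
    intro i
    have := i.2
    rw [Fin.val_rev]; omega
  refine ⟨?_, ?_, ?_, ?_⟩
  · intro x
    rcases cases_x L k x with ⟨i, rfl⟩ | hx
    · rw [Phi_in, hrev, Phi_in, h2, h1, hrev, Fin.rev_rev]
    · rw [Phi_out π x hx, Phi_out π x hx]
  · intro x
    rcases cases_x L k x with ⟨i, rfl⟩ | hx
    · rw [← sub_sub, hrev, Phi_in, Phi_in, h2, hrev, Fin.rev_rev, hrev]
      have := (π i).2
      rw [Fin.val_rev]; omega
    · rw [Phi_out π x hx, Phi_out π _ (by omega)]
  · intro x hx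
    exact Phi_out π x (Or.inl hx)
  · intro p q i j hpq hqi hij a b c
    have facts : ∀ y, (∃ z : Fin k, y = L + (z : ℕ) ∧ Phi e L k π y = e - L - (π z : ℕ)) ∨
        ((y < L ∨ L + k ≤ y) ∧ Phi e L k π y = y) := by
      intro y
      rcases cases_x L k y with ⟨z, rfl⟩ | hy
      · left; exact ⟨z, rfl, Phi_in π z⟩
      · right; exact ⟨hy, Phi_out π y hy⟩
    have rng : ∀ y, (y < L ∧ Phi e L k π y = y) ∨ (L + k ≤ y ∧ Phi e L k π y = y) ∨
        (L ≤ y ∧ y < L + k ∧ L ≤ Phi e L k π y ∧ Phi e L k π y < L + k) := by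
      intro y
      rcases facts y with ⟨z, hz, hz'⟩ | hy
      · have := z.2
        have := (π z).2
        omega
      · omega
    have rp := rng p
    have rq := rng q
    have ri := rng i
    have rj := rng j
    rcases facts p with ⟨p', hp, hp'⟩ | hp
    swap
    · omega
    rcases facts q with ⟨q', hq, hq'⟩ | hq
    swap
    · omega
    rcases facts i with ⟨i', hi, hi'⟩ | hi
    swap
    · omega
    rcases facts j with ⟨j', hj, hj'⟩ | hj
    swap
    · omega
    refine h3 p' q' i' j' ?_ ?_ ?_ ⟨?_, ?_, ?_⟩ <;> rw [Fin.lt_def] <;> omega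

theorem Phi_bij {e L : ℤ} {k : ℕ} (hk : e + 1 = 2 * L + k) :
    Set.BijOn (Phi e L k) {π | Good k π} {τ | MemX e L τ} := by
  refine ⟨fun π h => Phi_mem hk h, ?_, ?_⟩
  · intro π _ π' _ hh
    apply Equiv.ext
    intro i
    have := congrFun hh (L + (i : ℕ))
    rw [Phi_in, Phi_in] at this
    ext
    omega
  · intro τ h
    have h : MemX e L τ := h
    have r : ∀ i : Fin k, L ≤ τ (L + (i : ℕ)) ∧ τ (L + (i : ℕ)) ≤ e - L := by
      intro i
      have := i.2
      exact ⟨h.ge _ (by omega), h.le _ (by omega)⟩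
    let f : Fin k → Fin k := fun i => ⟨(e - L - τ (L + (i : ℕ))).toNat, by have := r i; omega⟩
    have hf : ∀ i : Fin k, L + ((f i : ℕ) : ℤ) = e - τ (L + (i : ℕ)) := by
      intro i
      have := r i
      simp only [f]
      omega
    have finv : Function.Involutive f := by
      intro i
      have a := hf (f i)
      rw [hf i, h.sym, h.inv] at a
      ext
      omega
    refine ⟨finv.toPerm f, ⟨?_, ?_, ?_⟩, ?_⟩
    · intro i; exact finv i
    · intro i
      show f (Fin.rev i) = Fin.rev (f i)
      have a := hf (Fin.rev i)
      have := i.2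
      have := (f i).2
      have := hf i
      rw [show L + ((Fin.rev i : Fin k) : ℕ) = e - (L + ((i : ℕ) : ℤ)) by
        rw [Fin.val_rev]; omega, h.sym] at a
      ext
      rw [Fin.val_rev]; omega
    · intro p q i j hpq hqi hij
      show ¬ (f j < f i ∧ f p < f j ∧ f q < f j)
      rintro ⟨a, b, c⟩
      rw [Fin.lt_def] at *
      have := hf p
      have := hf q
      have := hf i
      have := hf j
      exact h.av (L + (p : ℕ)) (L + (q : ℕ)) (L + (i : ℕ)) (L + (j : ℕ)) (by omega) (by omega)
        (by omega) (by omega) (by omega) (by omega)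
    · funext x
      rcases cases_x L k x with ⟨i, rfl⟩ | hx
      · rw [Phi_in]
        show e - L - ((f i : ℕ) : ℤ) = _
        have := hf i
        omega
      · rw [Phi_out _ x hx]
        rcases hx with hx | hx
        · exact (h.supp x hx).symm
        · exact (h.supp' x (by omega)).symm

theorem g_X {e L : ℤ} {k : ℕ} (hk : e + 1 = 2 * L + k) : g k = {τ | MemX e L τ}.ncard := by
  rw [g_eq]; exact ncard_bij (Phi_bij hk)

theorem g_rec (k : ℕ) : g (k + 6) + g (k + 2) + g k = 3 * g (k + 4) := by
  have hfin : {τ | MemX ((k : ℤ) + 5) 0 τ}.Finite := by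
    have := (Phi_bij (e := (k : ℤ) + 5) (L := 0) (k := k + 6) (by push_cast; omega))
    rw [← this.image_eq]
    exact (Set.toFinite _).image _
  have := rec_X (e := (k : ℤ) + 5) (by omega) hfin
  rw [g_X (e := (k : ℤ) + 5) (L := 0) (k := k + 6) (by push_cast; omega),
    g_X (e := (k : ℤ) + 5) (L := 1) (k := k + 4) (by push_cast; omega),
    g_X (e := (k : ℤ) + 5) (L := 2) (k := k + 2) (by push_cast; omega),
    g_X (e := (k : ℤ) + 5) (L := 3) (k := k) (by omega)]
  exact this

theorem g_pell_even (n : ℕ) : g (2 * n + 4) = 2 * g (2 * n + 2) + g (2 * n) := by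
  induction n with
  | zero => norm_num [g0, g2, g4]
  | succ n ih =>
    have := g_rec (2 * n)
    rw [show 2 * (n + 1) + 4 = 2 * n + 6 by ring, show 2 * (n + 1) + 2 = 2 * n + 4 by ring,
      show 2 * (n + 1) = 2 * n + 2 by ring]
    omega

theorem g_pell_odd (n : ℕ) : g (2 * n + 5) = 2 * g (2 * n + 3) + g (2 * n + 1) := by
  induction n with
  | zero => norm_num [g1, g3, g5]
  | succ n ih =>
    have := g_rec (2 * n + 1)
    rw [show 2 * (n + 1) + 5 = 2 * n + 1 + 6 by ring,
      show 2 * (n + 1) + 3 = 2 * n + 1 + 4 by ring,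
      show 2 * (n + 1) + 1 = 2 * n + 1 + 2 by ring]
    rw [show 2 * n + 5 = 2 * n + 1 + 4 by ring,
      show 2 * n + 3 = 2 * n + 1 + 2 by ring] at ih
    omega

theorem g_even_odd (n : ℕ) : g (2 * n) = g (2 * n + 1) ∧ g (2 * n + 2) = g (2 * n + 3) := by
  induction n with
  | zero => norm_num [g0, g1, g2, g3]
  | succ n ih =>
    have a := g_pell_even n
    have b := g_pell_odd n
    refine ⟨ih.2, ?_⟩
    rw [show 2 * (n + 1) + 2 = 2 * n + 4 by ring, show 2 * (n + 1) + 3 = 2 * n + 5 by ring]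
    omega

theorem stmt_19 :
    (∀ n : ℕ, 1 ≤ n → g (2 * n) = g (2 * n + 1)) ∧
      g 2 = 2 ∧ g 4 = 5 ∧
      ∀ n : ℕ, 3 ≤ n → g (2 * n) = 2 * g (2 * n - 2) + g (2 * n - 4) := by
  refine ⟨fun n _ => (g_even_odd n).1, g2, g4, ?_⟩
  intro n hn
  obtain ⟨m, rfl⟩ := Nat.exists_eq_add_of_le hn
  have := g_pell_even (m + 1)
  rw [show 2 * (3 + m) - 2 = 2 * (m + 1) + 2 by omega, show 2 * (3 + m) - 4 = 2 * (m + 1) by omega,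
    show 2 * (3 + m) = 2 * (m + 1) + 4 by omega]
  exact this
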